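/- arXiv:math/0602637 — 2 statements merged into one kernel-verified Lean document; each statement's English description precedes it below -/
import Mathlib

section
/- Let p be an odd prime, let a, b, c, k be integers with k ≥ 0 and gcd(c, p) = 1, and let f ∈ ℤ[t] be any polynomial with integer coefficients. Let ζ be a primitive p^k-th root of unity and set g(t) = a + bt + ct² + p·f(t). Then Norm_{ℚ(ζ_{p^k})/ℚ}( Σ_{t=0}^{p^k−1} ζ^{g(t)} ) = Norm_{ℚ(ζ_{p^k})/ℚ}( Σ_{t=0}^{p^k−1} ζ^{t²} ) = p^{(1/2)·k·(p−1)·p^{k−1}}. -/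
noncomputable section

open IntermediateField

/-- An intermediate field is closed under integer powers. -/
theorem IF.zpow_mem (F : IntermediateField ℚ ℂ) {x : ℂ} (hx : x ∈ F) (n : ℤ) :
    x ^ n ∈ F :=
  F.toSubfield.zpow_mem hx n


theorem aux_sum {p k : ℕ} (hp : p.Prime) (hodd : p ≠ 2) (a b c : ℤ)
    (hc : Int.gcd c (p : ℤ) = 1) (f : Polynomial ℤ)
    (ψ : AddChar (ZMod (p^k)) ℂ) (hψ : ψ.IsPrimitive) [NeZero (p^k)]
    (G : ZMod (p^k) → ZMod (p^k))
    (hG : ∀ t, G t = a + b * t + c * t^2 + p * (f.map (Int.castRingHom _)).eval t) :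
    (∑ t, ψ (G t)) * (∑ t, ψ (-G t)) = (p:ℂ)^k := by
  classical
  set F := f.map (Int.castRingHom (ZMod (p^k))) with hF
  have key : ∀ u : ZMod (p^k), ∃ h : ZMod (p^k) → ZMod (p^k), Function.Bijective h ∧
      ∀ s, G (u + s) - G s = h s * u := by
    intro u
    have h1 := Polynomial.sub_dvd_eval_sub (Polynomial.X + Polynomial.C u) Polynomial.X (F.map Polynomial.C)
    obtain ⟨q, hq⟩ := h1
    have h2 : ∀ s, F.eval (u + s) - F.eval s = u * q.eval s := by
      intro s
      have := congrArg (Polynomial.eval s) hq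
      simpa [Polynomial.eval_map, ← Polynomial.comp.eq_1, Polynomial.eval_comp, add_comm] using this
    refine ⟨fun s => b + c * (2 * s + u) + p * q.eval s, ?_, ?_⟩
    · rw [← Finite.injective_iff_bijective]
      intro s s' hs
      obtain ⟨w, hw⟩ := Polynomial.sub_dvd_eval_sub s s' q
      have h3 : (s - s') * (2 * c + p * w) = 0 := by
        have : (b + c * (2 * s + u) + p * q.eval s : ZMod (p^k)) = b + c * (2 * s' + u) + p * q.eval s' := hs
        linear_combination this - p * hw
      have hu : IsUnit (2 * c + p * w : ZMod (p^k)) := by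
        have hn : IsNilpotent (p * w : ZMod (p^k)) := by
          refine ⟨k, ?_⟩
          rw [mul_pow]
          have : ((p ^ k : ℕ) : ZMod (p^k)) = 0 := ZMod.natCast_self _
          push_cast at this
          rw [this, zero_mul]
        have h2c : IsUnit (2 * c : ZMod (p^k)) := by
          have : IsCoprime (2 * c) ((p^k : ℕ) : ℤ) := by
            push_cast
            apply IsCoprime.pow_right
            apply IsCoprime.mul_left
            · have := (Nat.coprime_primes Nat.prime_two hp).2 (Ne.symm hodd)
              exact_mod_cast Nat.isCoprime_iff_coprime.2 this
            · exact Int.isCoprime_iff_gcd_eq_one.2 hc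
          obtain ⟨x, y, hxy⟩ := this
          have h := congrArg (Int.cast : ℤ → ZMod (p^k)) hxy
          rw [Int.cast_add, Int.cast_mul y, Int.cast_natCast, ZMod.natCast_self, mul_zero, add_zero] at h
          refine IsUnit.of_mul_eq_one (x : ZMod (p^k)) ?_
          push_cast at h
          rw [mul_comm]; exact h
        exact hn.isUnit_add_left_of_commute h2c (Commute.all _ _)
      have := (hu.mul_left_eq_zero).1 h3
      exact sub_eq_zero.1 this
    · intro s
      rw [hG, hG]
      linear_combination p * h2 s
  rw [mul_comm, Finset.sum_mul_sum]
  have e1 : ∀ s, ∑ t, ψ (-G s) * ψ (G t) = ∑ u, ψ (G (u + s) - G s) := by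
    intro s
    rw [← Equiv.sum_comp (Equiv.addRight s)]
    apply Finset.sum_congr rfl
    intro u _
    rw [← AddChar.map_add_eq_mul]
    congr 1
    simp
    ring
  simp_rw [e1]
  rw [Finset.sum_comm]
  have e2 : ∀ u, ∑ s, ψ (G (u + s) - G s) = if u = 0 then (p:ℂ)^k else 0 := by
    intro u
    obtain ⟨h, hb, hh⟩ := key u
    simp_rw [hh]
    rw [hb.sum_comp (fun r => ψ (r * u)), AddChar.sum_mulShift u hψ]
    simp
  simp_rw [e2]
  simp

theorem aux_norm {p k : ℕ} (hp : p.Prime) (hodd : p ≠ 2) (a b c : ℤ)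
    (hc : Int.gcd c (p : ℤ) = 1) (f : Polynomial ℤ)
    (ζ : ℂ) (hζ : IsPrimitiveRoot ζ (p ^ k)) :
    (∑ t ∈ Finset.range (p ^ k),
      ζ ^ (a + b * (t : ℤ) + c * (t : ℤ) ^ 2 + (p : ℤ) * f.eval (t : ℤ))) *
    (starRingEnd ℂ) (∑ t ∈ Finset.range (p ^ k),
      ζ ^ (a + b * (t : ℤ) + c * (t : ℤ) ^ 2 + (p : ℤ) * f.eval (t : ℤ))) = (p:ℂ)^k := by
  have : NeZero (p^k) := ⟨(pow_pos hp.pos k).ne'⟩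
  have hψ := AddChar.zmodChar_primitive_of_primitive_root (p^k) hζ
  set ψ := AddChar.zmodChar (p^k) ((IsPrimitiveRoot.iff_def ζ (p^k)).mp hζ).left with hψd
  have hz : ∀ n : ℤ, ψ (n : ZMod (p^k)) = ζ ^ n := by
    have h1 : ψ 1 = ζ := by
      have := AddChar.zmodChar_apply' (n := p^k) ((IsPrimitiveRoot.iff_def ζ (p^k)).mp hζ).left 1
      simpa using this
    intro n
    have := AddChar.map_zsmul_eq_zpow ψ n 1
    rw [h1] at this
    simpa using this
  let G : ZMod (p^k) → ZMod (p^k) := fun t => a + b * t + c * t^2 + p * (f.map (Int.castRingHom _)).eval t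
  have hGc : ∀ t : ℕ, G (t : ZMod (p^k)) = ((a + b * (t : ℤ) + c * (t : ℤ) ^ 2 + (p : ℤ) * f.eval (t : ℤ) : ℤ) : ZMod (p^k)) := by
    intro t
    simp only [G]
    push_cast
    have : Polynomial.eval (t : ZMod (p^k)) (f.map (Int.castRingHom (ZMod (p^k)))) = ((f.eval (t:ℤ) : ℤ) : ZMod (p^k)) :=
      Polynomial.eval_natCast_map (Int.castRingHom (ZMod (p^k))) f t
    rw [this]
  have hs : ∀ H : ZMod (p^k) → ℂ, ∑ t ∈ Finset.range (p^k), H (t : ZMod (p^k)) = ∑ t, H t := by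
    intro H
    refine Finset.sum_bij' (fun t _ => (t : ZMod (p^k))) (fun t _ => t.val) ?_ ?_ ?_ ?_ ?_
    · simp
    · intro t _; simpa using ZMod.val_lt t
    · intro t ht; exact ZMod.val_cast_of_lt (by simpa using ht)
    · intro t _; simp
    · simp
  have hm := aux_sum hp hodd a b c hc f ψ hψ G (fun _ => rfl)
  rw [← hs, ← hs] at hm
  rw [map_sum]
  rw [← hm]
  congr 1
  · exact Finset.sum_congr rfl fun t _ => by rw [hGc, hz]
  · refine Finset.sum_congr rfl fun t _ => ?_
    rw [hGc, ← Int.cast_neg, hz, zpow_neg, ← hz, ← AddChar.inv_apply_eq_conj]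

theorem aux_main {p k : ℕ} (hp : p.Prime) (hodd : p ≠ 2) (a b c : ℤ)
    (hc : Int.gcd c (p : ℤ) = 1) (f : Polynomial ℤ)
    (ζ : ℂ) (hζ : IsPrimitiveRoot ζ (p ^ k)) (x : IntermediateField.adjoin ℚ {ζ})
    (hx : (x : ℂ) = ∑ t ∈ Finset.range (p ^ k),
      ζ ^ (a + b * (t : ℤ) + c * (t : ℤ) ^ 2 + (p : ℤ) * f.eval (t : ℤ))) :
    Algebra.norm ℚ x = (p : ℚ) ^ (k * (p - 1) * p ^ (k - 1) / 2) := by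
  rcases Nat.eq_zero_or_pos k with rfl | hk
  · have h1 : ζ = 1 := by simpa using hζ
    have : x = 1 := by
      apply Subtype.ext
      rw [hx]; simp [h1]
    simp [this]
  have : NeZero (p^k) := ⟨(pow_pos hp.pos k).ne'⟩
  have hcyc : IsCyclotomicExtension {p^k} ℚ (IntermediateField.adjoin ℚ {ζ}) := by
    change IsCyclotomicExtension {p^k} ℚ (IntermediateField.adjoin ℚ {ζ}).toSubalgebra
    rw [IntermediateField.adjoin_simple_toSubalgebra_of_isAlgebraic
      (hζ.isIntegral (pow_pos hp.pos k)).tower_top.isAlgebraic]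
    exact hζ.adjoin_isCyclotomicExtension ℚ
  have : FiniteDimensional ℚ (IntermediateField.adjoin ℚ {ζ}) := IsCyclotomicExtension.finiteDimensional {p^k} ℚ _
  have hfin : Module.finrank ℚ (IntermediateField.adjoin ℚ {ζ}) = p^(k-1) * (p-1) := by
    rw [IsCyclotomicExtension.finrank (n := p^k) _ (Polynomial.cyclotomic.irreducible_rat (pow_pos hp.pos k)), Nat.totient_prime_pow hp hk]
  have hn := Algebra.norm_eq_prod_embeddings ℚ ℂ x
  set z : IntermediateField.adjoin ℚ {ζ} := ⟨ζ, IntermediateField.subset_adjoin ℚ {ζ} rfl⟩ with hzd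
  have hz : IsPrimitiveRoot z (p^k) := by
    apply IsPrimitiveRoot.of_map_of_injective (f := (IntermediateField.adjoin ℚ {ζ}).val) hζ
    exact Subtype.val_injective
  have hxz : x = ∑ t ∈ Finset.range (p ^ k),
      z ^ (a + b * (t : ℤ) + c * (t : ℤ) ^ 2 + (p : ℤ) * f.eval (t : ℤ)) := by
    apply Subtype.ext
    rw [hx]; push_cast; rfl
  have hσ : ∀ σ : IntermediateField.adjoin ℚ {ζ} →ₐ[ℚ] ℂ, σ x * (starRingEnd ℂ) (σ x) = (p:ℂ)^k := by
    intro σ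
    have := aux_norm hp hodd a b c hc f (σ z) (hz.map_of_injective σ.injective)
    have e : σ x = ∑ t ∈ Finset.range (p ^ k),
      (σ z) ^ (a + b * (t : ℤ) + c * (t : ℤ) ^ 2 + (p : ℤ) * f.eval (t : ℤ)) := by
      rw [hxz]; simp
    rw [e]; exact this
  set r : ℂ := ((Real.sqrt (p^k) : ℝ) : ℂ) with hr
  have hr2 : r * r = (p:ℂ)^k := by
    rw [hr, ← Complex.ofReal_mul, Real.mul_self_sqrt (by positivity)]; simp
  have hr0 : r ≠ 0 := by
    intro h; rw [h] at hr2
    have : (p:ℂ)^k ≠ 0 := pow_ne_zero _ (by exact_mod_cast hp.ne_zero)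
    simp at hr2; exact this hr2.symm
  let cj : ℂ →ₐ[ℚ] ℂ := (Complex.conjAe.toAlgHom).restrictScalars ℚ
  have hcj : ∀ w, cj w = (starRingEnd ℂ) w := fun w => rfl
  have hone : ∏ σ : IntermediateField.adjoin ℚ {ζ} →ₐ[ℚ] ℂ, (σ x / r) = 1 := by
    refine Finset.prod_involution (fun σ _ => cj.comp σ) ?_ ?_ ?_ ?_
    · intro σ _
      simp only [AlgHom.comp_apply, hcj]
      rw [div_mul_div_comm, hσ, hr2, div_self]
      rw [← hr2]; exact mul_ne_zero hr0 hr0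
    · intro σ _ _ h
      have hzσ := hz.map_of_injective σ.injective
      have h1 : (starRingEnd ℂ) (σ z) = σ z := by
        rw [← hcj]; exact DFunLike.congr_fun h z
      have h2 : ‖σ z‖ = 1 := hzσ.norm'_eq_one (NeZero.ne _)
      have h3 : (σ z)^2 = 1 := by
        have := Complex.mul_conj (σ z)
        rw [h1, Complex.normSq_eq_norm_sq, h2] at this
        simpa [sq] using this
      have h4 := Nat.le_of_dvd (by norm_num) (hzσ.dvd_of_pow_eq_one 2 h3)
      have h5 : p ≤ p^k := Nat.le_self_pow hk.ne' p
      have := hp.two_le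
      omega
    · simp
    · intro σ _
      ext w
      simp [hcj]
  rw [Finset.prod_div_distrib, Finset.prod_const, ← hn, Finset.card_univ, AlgHom.card, hfin] at hone
  have hN := (div_eq_one_iff_eq (pow_ne_zero _ hr0)).1 hone
  obtain ⟨m, hm⟩ : 2 ∣ p - 1 := by
    have := hp.eq_two_or_odd'
    rcases this with h | ⟨m, h⟩
    · exact absurd h hodd
    · exact ⟨m, by omega⟩
  have hexp : k * (p-1) * p^(k-1) / 2 = k * (p^(k-1) * m) := by
    rw [hm]
    apply Nat.div_eq_of_eq_mul_left (by norm_num)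
    ring
  have : ((Algebra.norm ℚ x : ℚ) : ℂ) = (((p : ℚ) ^ (k * (p - 1) * p ^ (k - 1) / 2) : ℚ) : ℂ) := by
    rw [hexp]
    push_cast
    rw [pow_mul, ← hr2]
    have h6 : p^(k-1) * (p-1) = 2 * (p^(k-1) * m) := by rw [hm]; ring
    rw [h6, pow_mul, sq] at hN
    exact hN
  exact_mod_cast this

/-- Let `p` be an odd prime, `a, b, c, k ∈ ℤ`, `k ≥ 0`,
`gcd(c,p) = 1`, `f ∈ ℤ[t]`, and `ζ` a primitive `p^k`-th root of unity in `ℂ`.  With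
`g(t) = a + bt + ct² + p·f(t)`, one has
`N_{ℚ(ζ)/ℚ}(Σ_{t<p^k} ζ^{g(t)}) = N_{ℚ(ζ)/ℚ}(Σ_{t<p^k} ζ^{t²}) = p^{k(p−1)p^{k−1}/2}`. -/
theorem stmt13 (p k : ℕ) (hp : p.Prime) (hodd : p ≠ 2) (a b c : ℤ)
    (hc : Int.gcd c (p : ℤ) = 1) (f : Polynomial ℤ)
    (ζ : ℂ) (hζ : IsPrimitiveRoot ζ (p ^ k)) :
    Algebra.norm ℚ
        (⟨∑ t ∈ Finset.range (p ^ k),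
            ζ ^ (a + b * (t : ℤ) + c * (t : ℤ) ^ 2 + (p : ℤ) * f.eval (t : ℤ)),
          sum_mem fun t _ =>
            IF.zpow_mem _ (IntermediateField.subset_adjoin ℚ {ζ} rfl) _⟩ :
          ↥(IntermediateField.adjoin ℚ {ζ})) =
      Algebra.norm ℚ
        (⟨∑ t ∈ Finset.range (p ^ k), ζ ^ (t ^ 2),
          sum_mem fun t _ =>
            pow_mem (IntermediateField.subset_adjoin ℚ {ζ} rfl) _⟩ :
          ↥(IntermediateField.adjoin ℚ {ζ})) ∧
    Algebra.norm ℚ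
        (⟨∑ t ∈ Finset.range (p ^ k), ζ ^ (t ^ 2),
          sum_mem fun t _ =>
            pow_mem (IntermediateField.subset_adjoin ℚ {ζ} rfl) _⟩ :
          ↥(IntermediateField.adjoin ℚ {ζ})) =
      (p : ℚ) ^ (k * (p - 1) * p ^ (k - 1) / 2) := by
  have h2 : Algebra.norm ℚ
        (⟨∑ t ∈ Finset.range (p ^ k), ζ ^ (t ^ 2),
          sum_mem fun t _ =>
            pow_mem (IntermediateField.subset_adjoin ℚ {ζ} rfl) _⟩ :
          ↥(IntermediateField.adjoin ℚ {ζ})) =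
      (p : ℚ) ^ (k * (p - 1) * p ^ (k - 1) / 2) := by
    refine aux_main hp hodd 0 0 1 (by simp) 0 ζ hζ _ ?_
    dsimp only; apply Finset.sum_congr rfl; intro t _
    simp only [zero_mul, zero_add, one_mul, Polynomial.eval_zero, mul_zero, add_zero]
    rw [← zpow_natCast]
    push_cast
    rfl
  refine ⟨?_, h2⟩
  rw [h2]
  exact aux_main hp hodd a b c hc f ζ hζ _ rfl

end
end

section
/- Let p be an odd prime and r, s ≥ 1, with r ≥ min{2, s} if p = 3. Let ζ = ζ_{p^{r+s}} be a primitive p^{r+s}-th root of unity, L = ℚ(ζ), K = ℚ(ζ_{p^r}), G = Gal(L/K) = ⟨σ_{1+p^r}⟩, where σ_i(ζ) = ζ^i. Let χ be a character of G of order p^s, and define a ∈ ℕ by χ(σ_{1+p^r}) = ζ^{a·p^r}. Let b be an integer with gcd(b, p) = 1 and let ⟨ζ^b|χ⟩ = Σ_{j=0}^{p^s−1} χ(σ_{1+p^r}^{−j})·σ_{(1+p^r)^j}(ζ^b) be the resolvent. Then the absolute norm of the ideal (⟨ζ^b|χ⟩) of ℤ[ζ] equals: p^{s(p−1)p^{r+s−1}}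 if s ≤ r and v_p(b−a) ≥ s; p^{(1/2)(s+r)(p−1)p^{r+s−1}} if s > r and v_p(b−a) ≥ r; and 0 (i.e., the resolvent itself is 0) otherwise. -/
noncomputable section

open IntermediateField

/-- The standard choice of primitive `n`-th root of unity, `ζ_n = e^{2πi/n}`. -/
noncomputable def zetaC (n : ℕ) : ℂ := Complex.exp (2 * Real.pi * Complex.I / n)

/-- The `n`-th cyclotomic field `ℚ(ζ_n)`, realized as a subfield of `ℂ`. -/
noncomputable def Qcyc (n : ℕ) : IntermediateField ℚ ℂ := IntermediateField.adjoin ℚ {zetaC n}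

/-- `ζ_n` as an element of `ℚ(ζ_n)`. -/
noncomputable def zetaEl (n : ℕ) : ↥(Qcyc n) :=
  ⟨zetaC n, IntermediateField.subset_adjoin ℚ {zetaC n} rfl⟩

lemma aux_lte (p : ℕ) (hp : p.Prime) (hodd : p ≠ 2) (r m : ℕ) (hr : 1 ≤ r) (h : ℕ) :
    (p : ℤ) ^ (r + m) ∣ (1 + (p : ℤ) ^ r) ^ h - 1 ↔ p ^ m ∣ h := by
  have hd : (p : ℤ) ∣ (1 + (p : ℤ) ^ r) - 1 := by
    simpa using dvd_pow_self (p : ℤ) (by omega : r ≠ 0)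
  have hnd : ¬ (p : ℤ) ∣ (1 + (p : ℤ) ^ r) := by
    intro h1
    have h2 : (p : ℤ) ∣ 1 := by
      have := dvd_sub h1 hd
      simpa using this
    have h3 : p ∣ 1 := by exact_mod_cast h2
    exact hp.one_lt.ne' (Nat.dvd_one.mp h3)
  have key := Int.emultiplicity_pow_sub_pow hp (hp.odd_of_ne_two hodd) hd hnd h
  have hr' : emultiplicity (p : ℤ) (1 + (p : ℤ) ^ r - 1) = r := by
    rw [add_sub_cancel_left]
    exact emultiplicity_pow_self_of_prime (Nat.prime_iff_prime_int.mp hp) r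
  rw [one_pow, hr'] at key
  rw [pow_dvd_iff_le_emultiplicity, pow_dvd_iff_le_emultiplicity, key]
  push_cast
  exact ENat.add_le_add_iff_left (ENat.natCast_ne_top r)

lemma aux_binom2 (u : ℤ) (n : ℕ) : ∃ k : ℤ, (1 + u) ^ n = 1 + n * u + k * u ^ 2 := by
  induction n with
  | zero => exact ⟨0, by simp⟩
  | succ n ih =>
    obtain ⟨k, hk⟩ := ih
    refine ⟨k + k * u + n, ?_⟩
    rw [pow_succ, hk]
    push_cast
    ring

lemma aux_binom3 (u : ℤ) (n : ℕ) :
    ∃ k : ℤ, (1 + u) ^ n = 1 + n * u + (n.choose 2 : ℕ) * u ^ 2 + k * u ^ 3 := by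
  induction n with
  | zero => exact ⟨0, by simp⟩
  | succ n ih =>
    obtain ⟨k, hk⟩ := ih
    refine ⟨k + k * u + (n.choose 2 : ℕ), ?_⟩
    rw [pow_succ, hk, Nat.choose_succ_succ' n 1]
    push_cast
    simp
    ring

lemma aux_pp (p : ℕ) (hp : p.Prime) (hodd : p ≠ 2) (r : ℕ) (hr : 1 ≤ r) (m : ℕ) :
    ∃ y : ℤ, (1 + (p : ℤ) ^ r) ^ (p ^ m) = 1 + (p : ℤ) ^ (r + m) * (1 + (p : ℤ) ^ r * y) := by
  induction m with
  | zero => exact ⟨0, by simp⟩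
  | succ m ih =>
    obtain ⟨y, hy⟩ := ih
    have h2 := hp.two_le
    have hc : p ∣ p.choose 2 := hp.dvd_choose_self (by norm_num) (by omega)
    obtain ⟨c, hc⟩ := hc
    obtain ⟨k, hk⟩ := aux_binom3 ((p : ℤ) ^ (r + m) * (1 + (p : ℤ) ^ r * y)) p
    rw [pow_succ, pow_mul, hy, hk, hc]
    obtain ⟨r, rfl⟩ : ∃ r', r = r' + 1 := ⟨r - 1, by omega⟩
    refine ⟨y + c * (p : ℤ) ^ m * (1 + (p : ℤ) ^ (r + 1) * y) ^ 2
      + k * (p : ℤ) ^ (r + 2 * m) * (1 + (p : ℤ) ^ (r + 1) * y) ^ 3, ?_⟩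
    push_cast
    ring

lemma aux_cong (p : ℕ) (hp : p.Prime) (hodd : p ≠ 2) (r s : ℕ) (hr : 1 ≤ r) (hrs : r < s) (t : ℕ) :
    (p : ℤ) ^ (r + s) ∣ (1 + (p : ℤ) ^ r) ^ (p ^ (s - r) * t) - (1 + (p : ℤ) ^ s * t) := by
  obtain ⟨y, hy⟩ := aux_pp p hp hodd r hr (s - r)
  rw [pow_mul, hy, show r + (s - r) = s by omega]
  obtain ⟨k, hk⟩ := aux_binom2 ((p : ℤ) ^ s * (1 + (p : ℤ) ^ r * y)) t
  rw [hk]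
  obtain ⟨d, rfl⟩ : ∃ d, s = r + d := ⟨s - r, by omega⟩
  refine ⟨t * y + k * (p : ℤ) ^ d * (1 + (p : ℤ) ^ r * y) ^ 2, ?_⟩
  ring

lemma aux_shift {M : Type*} [AddCommGroup M] (f : ℕ → M) (n : ℕ) (hf : ∀ i, f (i + n) = f i)
    (k : ℕ) : ∑ j ∈ Finset.range n, f (k + j) = ∑ j ∈ Finset.range n, f j := by
  induction k with
  | zero => simp
  | succ k ih =>
    rw [← ih]
    have h1 := Finset.sum_range_succ (fun j => f (k + j)) n
    have h2 := Finset.sum_range_succ' (fun j => f (k + j)) n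
    rw [h1] at h2
    simp only [hf, add_zero] at h2
    have h3 := add_right_cancel h2
    rw [h3]
    exact Finset.sum_congr rfl fun j _ => by congr 1; ring

lemma aux_filter {M : Type*} [AddCommGroup M] (g : ℕ → M) (m n : ℕ) (hm : 0 < m) :
    ∑ h ∈ Finset.range (m * n), (if m ∣ h then g h else 0) = ∑ t ∈ Finset.range n, g (m * t) := by
  induction n with
  | zero => simp
  | succ n ih =>
    rw [mul_add, mul_one, Finset.sum_range_add, ih, Finset.sum_range_succ]
    congr 1
    rw [Finset.sum_eq_single 0]
    · simp
    · intro x hx hx0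
      rw [if_neg]
      intro hd
      have := (Nat.dvd_add_right (dvd_mul_right m n)).mp hd
      exact hx0 (Nat.eq_zero_of_dvd_of_lt this (Finset.mem_range.mp hx))
    · intro h
      simp at h
      omega

lemma aux_geom {F : Type*} [Field F] (η : F) (n : ℕ) (h : η ^ n = 1)
    {P : Prop} [Decidable P] (hP : η = 1 ↔ P) :
    ∑ j ∈ Finset.range n, η ^ j = if P then (n : F) else 0 := by
  split_ifs with h1
  · simp [hP.mpr h1]
  · have h1 : η ≠ 1 := fun h => h1 (hP.mp h)
    have := mul_neg_geom_sum η n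
    rw [h, sub_self] at this
    exact (mul_eq_zero.mp this).resolve_left (sub_ne_zero.mpr (Ne.symm h1))

lemma aux_zcong {F : Type*} [Field F] {ζ : F} {n : ℕ} (hζ : IsPrimitiveRoot ζ n) (h0 : ζ ≠ 0)
    {x y : ℤ} (h : (n : ℤ) ∣ x - y) : ζ ^ x = ζ ^ y := by
  have : ζ ^ (x - y) = 1 := (hζ.zpow_eq_one_iff_dvd _).mpr h
  rw [zpow_sub₀ h0] at this
  exact (div_eq_one_iff_eq (zpow_ne_zero _ h0)).mp this

section
variable {F : Type*} [Field F] {ζ : F} (p r s : ℕ) (hp : p.Prime) (hodd : p ≠ 2) (hr : 1 ≤ r)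
  (hζ : IsPrimitiveRoot ζ (p ^ (r + s))) (h0 : ζ ≠ 0)

include hp hζ h0

lemma aux_small (hs : s ≤ r) (a : ℕ) (b : ℤ) :
    ∑ j ∈ Finset.range (p ^ s), ζ ^ (b * (1 + (p : ℤ) ^ r) ^ j - (a : ℤ) * (p : ℤ) ^ r * (j : ℤ)) =
      ζ ^ b * if (p : ℤ) ^ s ∣ b - a then ((p ^ s : ℕ) : F) else 0 := by
  have hpz : (p : ℤ) ≠ 0 := by exact_mod_cast hp.ne_zero
  set η : F := ζ ^ ((b - a) * (p : ℤ) ^ r) with hη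
  have h1 : η ^ (p ^ s) = 1 := by
    rw [hη, ← zpow_natCast, ← zpow_mul, hζ.zpow_eq_one_iff_dvd]
    refine ⟨b - a, ?_⟩
    push_cast
    ring
  have h2 : η = 1 ↔ (p : ℤ) ^ s ∣ b - a := by
    rw [hη, hζ.zpow_eq_one_iff_dvd]
    push_cast
    rw [pow_add, mul_comm ((p : ℤ) ^ r)]
    exact mul_dvd_mul_iff_right (pow_ne_zero _ hpz)
  rw [← aux_geom η _ h1 h2, Finset.mul_sum]
  refine Finset.sum_congr rfl fun j _ => ?_
  rw [hη, ← zpow_natCast, ← zpow_mul, ← zpow_add₀ h0]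
  apply aux_zcong hζ h0
  obtain ⟨k, hk⟩ := aux_binom2 ((p : ℤ) ^ r) j
  obtain ⟨d, rfl⟩ : ∃ d, r = s + d := ⟨r - s, by omega⟩
  refine ⟨b * k * p ^ d, ?_⟩
  rw [hk]
  push_cast
  ring

include hodd hr

lemma aux_inner (c : ℤ) :
    ∑ k ∈ Finset.range (p ^ s), ζ ^ (c * (1 + (p : ℤ) ^ r) ^ k) =
      ζ ^ c * if (p : ℤ) ^ s ∣ c then ((p ^ s : ℕ) : F) else 0 := by
  have hpz : (p : ℤ) ≠ 0 := by exact_mod_cast hp.ne_zero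
  set η : F := ζ ^ (c * (p : ℤ) ^ r) with hη
  have h1 : η ^ (p ^ s) = 1 := by
    rw [hη, ← zpow_natCast, ← zpow_mul, hζ.zpow_eq_one_iff_dvd]
    refine ⟨c, ?_⟩
    push_cast
    ring
  have h2 : η = 1 ↔ (p : ℤ) ^ s ∣ c := by
    rw [hη, hζ.zpow_eq_one_iff_dvd]
    push_cast
    rw [pow_add, mul_comm ((p : ℤ) ^ r)]
    exact mul_dvd_mul_iff_right (pow_ne_zero _ hpz)
  rw [← aux_geom η _ h1 h2, Finset.mul_sum]
  set x : ℕ → ℕ := fun k => ∑ i ∈ Finset.range k, (1 + p ^ r) ^ i with hx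
  have hxk : ∀ k, (1 + (p : ℤ) ^ r) ^ k = 1 + (p : ℤ) ^ r * (x k : ℤ) := by
    intro k
    have := mul_geom_sum (1 + (p : ℤ) ^ r) k
    simp only [hx]
    push_cast
    linear_combination -this
  have hps : 0 < p ^ s := pow_pos hp.pos s
  have hmap : Set.MapsTo (fun k => x k % p ^ s) (Finset.range (p ^ s)) (Finset.range (p ^ s)) := by
    intro k _
    simpa using Nat.mod_lt _ hps
  have hcop : IsCoprime ((p : ℤ) ^ (r + s)) (1 + (p : ℤ) ^ r) := by
    apply IsCoprime.pow_left
    obtain ⟨d, rfl⟩ : ∃ d, r = d + 1 := ⟨r - 1, by omega⟩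
    exact ⟨-(p : ℤ) ^ d, 1, by ring⟩
  have main : ∀ k l : ℕ, k ≤ l → l < p ^ s → x k % p ^ s = x l % p ^ s → k = l := by
    intro k l hkl hl h
    have e1 : (p : ℤ) ^ s ∣ (x l : ℤ) - x k := by
      have := (Nat.modEq_iff_dvd (n := p ^ s) (a := x k) (b := x l)).mp h
      exact_mod_cast this
    have e2 : (p : ℤ) ^ (r + s) ∣ (1 + (p : ℤ) ^ r) ^ k * ((1 + (p : ℤ) ^ r) ^ (l - k) - 1) := by
      rw [mul_sub, ← pow_add, Nat.add_sub_cancel' hkl, mul_one, hxk, hxk, pow_add]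
      obtain ⟨d, hd⟩ := e1
      exact ⟨d, by linear_combination (p : ℤ) ^ r * hd⟩
    have e3 := (hcop.pow_right (n := k)).dvd_of_dvd_mul_left e2
    rw [aux_lte p hp hodd r s hr] at e3
    have := Nat.eq_zero_of_dvd_of_lt e3 (by omega)
    omega
  have hinj : Set.InjOn (fun k => x k % p ^ s) (Finset.range (p ^ s)) := by
    intro k hk l hl h
    simp only [Finset.coe_range, Set.mem_Iio] at hk hl
    rcases le_total k l with hkl | hkl
    · exact main k l hkl hl h
    · exact (main l k hkl hk h.symm).symm
  refine Finset.sum_nbij (fun k => x k % p ^ s) hmap hinj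
    (Finset.surjOn_of_injOn_of_card_le _ hmap hinj le_rfl) ?_
  intro k _
  have e : η ^ (x k % p ^ s) = η ^ (x k) := by
    conv_rhs => rw [← Nat.mod_add_div (x k) (p ^ s), pow_add, pow_mul, h1, one_pow, mul_one]
  rw [e, hη, ← zpow_natCast, ← zpow_mul, ← zpow_add₀ h0, hxk]
  congr 1
  ring

lemma aux_big (hs : r < s) (a : ℕ) (b : ℤ) (hb : ¬ (p : ℤ) ∣ b) :
    (∑ j ∈ Finset.range (p ^ s),
        ζ ^ (b * (1 + (p : ℤ) ^ r) ^ j - (a : ℤ) * (p : ℤ) ^ r * (j : ℤ))) *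
    (∑ j ∈ Finset.range (p ^ s),
        (ζ⁻¹) ^ (b * (1 + (p : ℤ) ^ r) ^ j - (a : ℤ) * (p : ℤ) ^ r * (j : ℤ))) =
      if (p : ℤ) ^ r ∣ b - a then ((p ^ (s + r) : ℕ) : F) else 0 := by
  have hpz : (p : ℤ) ≠ 0 := by exact_mod_cast hp.ne_zero
  set f : ℕ → ℤ := fun j => b * (1 + (p : ℤ) ^ r) ^ j - (a : ℤ) * (p : ℤ) ^ r * (j : ℤ) with hf
  have hper : ∀ i, ζ ^ f (i + p ^ s) = ζ ^ f i := by
    intro i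
    apply aux_zcong hζ h0
    obtain ⟨d, hd⟩ := (aux_lte p hp hodd r s hr (p ^ s)).mpr dvd_rfl
    refine ⟨b * (1 + (p : ℤ) ^ r) ^ i * d - a, ?_⟩
    simp only [hf]
    push_cast
    rw [pow_add (1 + (p : ℤ) ^ r)]
    linear_combination b * (1 + (p : ℤ) ^ r) ^ i * hd
  have hbs : IsCoprime ((p : ℤ) ^ s) b :=
    IsCoprime.pow_left ((Nat.prime_iff_prime_int.mp hp).coprime_iff_not_dvd.mpr hb)
  have step1 : (∑ j ∈ Finset.range (p ^ s), ζ ^ f j) * (∑ j ∈ Finset.range (p ^ s), (ζ⁻¹) ^ f j) =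
      ∑ h ∈ Finset.range (p ^ s), if p ^ (s - r) ∣ h then
        ((p ^ s : ℕ) : F) * ζ ^ (b * ((1 + (p : ℤ) ^ r) ^ h - 1) - a * (p : ℤ) ^ r * h) else 0 := by
    rw [Finset.mul_sum]
    have : ∀ k ∈ Finset.range (p ^ s), (∑ j ∈ Finset.range (p ^ s), ζ ^ f j) * (ζ⁻¹) ^ f k =
        ∑ h ∈ Finset.range (p ^ s), ζ ^ (- (a * (p : ℤ) ^ r * h)) *
          ζ ^ (b * ((1 + (p : ℤ) ^ r) ^ h - 1) * (1 + (p : ℤ) ^ r) ^ k) := by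
      intro k _
      rw [← aux_shift (fun j => ζ ^ f j) (p ^ s) hper k, Finset.sum_mul]
      refine Finset.sum_congr rfl fun h _ => ?_
      rw [inv_zpow', ← zpow_add₀ h0, ← zpow_add₀ h0]
      congr 1
      simp only [hf]
      push_cast
      ring
    rw [Finset.sum_congr rfl this, Finset.sum_comm]
    refine Finset.sum_congr rfl fun h _ => ?_
    rw [← Finset.mul_sum, aux_inner p r s hp hodd hr hζ h0]
    have hiff : (p : ℤ) ^ s ∣ b * ((1 + (p : ℤ) ^ r) ^ h - 1) ↔ p ^ (s - r) ∣ h := by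
      rw [← aux_lte p hp hodd r (s - r) hr, show r + (s - r) = s by omega]
      exact ⟨hbs.dvd_of_dvd_mul_left, fun h => h.mul_left b⟩
    simp only [hiff]
    split_ifs
    · rw [← mul_assoc, ← zpow_add₀ h0, mul_comm]
      congr 2
      ring
    · simp
  rw [step1]
  have hpow : p ^ s = p ^ (s - r) * p ^ r := by rw [← pow_add]; congr 1; omega
  conv_lhs => rw [show Finset.range (p ^ s) = Finset.range (p ^ (s - r) * p ^ r) by rw [← hpow]]
  rw [aux_filter (fun h => ((p ^ s : ℕ) : F) *
    ζ ^ (b * ((1 + (p : ℤ) ^ r) ^ h - 1) - a * (p : ℤ) ^ r * h)) _ _ (pow_pos hp.pos _),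
    ← Finset.mul_sum]
  set η : F := ζ ^ ((b - a) * (p : ℤ) ^ s) with hη
  have h1 : η ^ (p ^ r) = 1 := by
    rw [hη, ← zpow_natCast, ← zpow_mul, hζ.zpow_eq_one_iff_dvd]
    refine ⟨b - a, ?_⟩
    push_cast
    ring
  have h2 : η = 1 ↔ (p : ℤ) ^ r ∣ b - a := by
    rw [hη, hζ.zpow_eq_one_iff_dvd]
    push_cast
    rw [pow_add]
    exact mul_dvd_mul_iff_right (pow_ne_zero _ hpz)
  have : ∀ t ∈ Finset.range (p ^ r), ζ ^ (b * ((1 + (p : ℤ) ^ r) ^ (p ^ (s - r) * t) - 1) -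
      a * (p : ℤ) ^ r * ((p ^ (s - r) * t : ℕ) : ℤ)) = η ^ t := by
    intro t _
    rw [hη, ← zpow_natCast, ← zpow_mul]
    apply aux_zcong hζ h0
    obtain ⟨d, hd⟩ := aux_cong p hp hodd r s hr hs t
    refine ⟨b * d, ?_⟩
    have hpow' : (p : ℤ) ^ s = p ^ (s - r) * p ^ r := by exact_mod_cast hpow
    push_cast
    linear_combination b * hd + a * t * hpow'
  rw [Finset.sum_congr rfl this, aux_geom η _ h1 h2]
  split_ifs
  · push_cast
    ring
  · simp

end

lemma aux_prim (n : ℕ) (hn : n ≠ 0) : IsPrimitiveRoot (zetaEl n) n := by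
  have h : IsPrimitiveRoot (zetaC n) n := Complex.isPrimitiveRoot_exp n hn
  exact IsPrimitiveRoot.of_map_of_injective (f := algebraMap (Qcyc n) ℂ) (show IsPrimitiveRoot (zetaC n) n from h)
    (algebraMap (Qcyc n) ℂ).injective

lemma aux_cyc (n : ℕ) (hn : n ≠ 0) : IsCyclotomicExtension {n} ℚ (Qcyc n) := by
  have h : IsPrimitiveRoot (zetaC n) n := Complex.isPrimitiveRoot_exp n hn
  have : NeZero n := ⟨hn⟩
  have hint : IsIntegral ℚ (zetaC n) := h.isIntegral (Nat.pos_of_ne_zero hn) |>.tower_top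
  change IsCyclotomicExtension {n} ℚ (IntermediateField.adjoin ℚ {zetaC n}).toSubalgebra
  rw [IntermediateField.adjoin_simple_toSubalgebra_of_isAlgebraic hint.isAlgebraic]
  exact h.adjoin_isCyclotomicExtension ℚ

lemma aux_aut (n : ℕ) (hn : n ≠ 0) :
    ∃ σ : Qcyc n ≃ₐ[ℚ] Qcyc n, σ (zetaEl n) = (zetaEl n)⁻¹ := by
  have := aux_cyc n hn
  have : IsGalois ℚ (Qcyc n) := IsCyclotomicExtension.isGalois {n} ℚ (Qcyc n)
  have h : IsPrimitiveRoot (zetaC n) n := Complex.isPrimitiveRoot_exp n hn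
  refine ⟨AlgEquiv.restrictNormal (Complex.conjAe.restrictScalars ℚ) (Qcyc n), ?_⟩
  apply (algebraMap (Qcyc n) ℂ).injective
  rw [AlgEquiv.restrictNormal_commutes, map_inv₀]
  have h1 : ‖zetaC n‖ = 1 := h.norm'_eq_one hn
  exact (Complex.inv_eq_conj h1).symm

/-- Let `p` be an odd prime, `r, s ≥ 1` (and `r ≥ min{2,s}` if
`p = 3`).  Let `ζ = ζ_{p^{r+s}}`, `L = ℚ(ζ)`, `K = ℚ(ζ_{p^r})`,
`G = Gal(L/K) = ⟨σ_{1+p^r}⟩`, and let `χ` be a character of `G` of order `p^s`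
determined by `χ(σ_{1+p^r}) = ζ^{a p^r}` (so `p ∤ a`).  For `b ∈ ℤ` coprime to `p`, the
resolvent is `⟨ζ^b|χ⟩ = Σ_{j<p^s} χ(σ_{1+p^r}^{-j})·σ_{(1+p^r)^j}(ζ^b)
            = Σ_{j<p^s} ζ^{b(1+p^r)^j − a p^r j}`.
Its ideal in `ℤ[ζ]` has absolute norm `p^{s(p−1)p^{r+s−1}}` if `s ≤ r` and
`v_p(b−a) ≥ s`; norm `p^{(s+r)(p−1)p^{r+s−1}/2}` if `s > r` and `v_p(b−a) ≥ r`; and the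
resolvent is `0` otherwise. -/
theorem stmt15 (p r s : ℕ) (hp : p.Prime) (hodd : p ≠ 2) (hr : 1 ≤ r) (hs : 1 ≤ s)
    (h3 : p = 3 → min 2 s ≤ r)
    (a : ℕ) (ha : ¬ (p : ℤ) ∣ (a : ℤ)) (b : ℤ) (hb : ¬ (p : ℤ) ∣ b) :
    (s ≤ r → (p : ℤ) ^ s ∣ (b - (a : ℤ)) →
      |Algebra.norm ℚ (∑ j ∈ Finset.range (p ^ s),
          zetaEl (p ^ (r + s)) ^
            (b * (1 + (p : ℤ) ^ r) ^ j - (a : ℤ) * (p : ℤ) ^ r * (j : ℤ)))| =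
        (p : ℚ) ^ (s * (p - 1) * p ^ (r + s - 1))) ∧
    (r < s → (p : ℤ) ^ r ∣ (b - (a : ℤ)) →
      |Algebra.norm ℚ (∑ j ∈ Finset.range (p ^ s),
          zetaEl (p ^ (r + s)) ^
            (b * (1 + (p : ℤ) ^ r) ^ j - (a : ℤ) * (p : ℤ) ^ r * (j : ℤ)))| =
        (p : ℚ) ^ ((s + r) * (p - 1) * p ^ (r + s - 1) / 2)) ∧
    (¬ ((s ≤ r ∧ (p : ℤ) ^ s ∣ (b - (a : ℤ))) ∨ (r < s ∧ (p : ℤ) ^ r ∣ (b - (a : ℤ)))) →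
      (∑ j ∈ Finset.range (p ^ s),
          zetaEl (p ^ (r + s)) ^
            (b * (1 + (p : ℤ) ^ r) ^ j - (a : ℤ) * (p : ℤ) ^ r * (j : ℤ))) = 0) := by
  have hp0 : p ^ (r + s) ≠ 0 := pow_ne_zero _ hp.ne_zero
  have hζ := aux_prim (p ^ (r + s)) hp0
  have h0 : zetaEl (p ^ (r + s)) ≠ 0 := hζ.ne_zero hp0
  have hcyc := aux_cyc (p ^ (r + s)) hp0
  have : NeZero (p ^ (r + s)) := ⟨hp0⟩
  have hfin : Module.finrank ℚ (Qcyc (p ^ (r + s))) = (p - 1) * p ^ (r + s - 1) := by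
    rw [IsCyclotomicExtension.finrank (n := p ^ (r + s)) _
      (Polynomial.cyclotomic.irreducible_rat (Nat.pos_of_ne_zero hp0)),
      Nat.totient_prime_pow hp (by omega), mul_comm]
  have hnorm : ∀ m : ℕ, Algebra.norm ℚ ((m : ℕ) : Qcyc (p ^ (r + s))) =
      (m : ℚ) ^ ((p - 1) * p ^ (r + s - 1)) := by
    intro m
    rw [← hfin, ← Algebra.norm_algebraMap (S := Qcyc (p ^ (r + s))), map_natCast (algebraMap ℚ _)]
  obtain ⟨σ, hσ⟩ := aux_aut (p ^ (r + s)) hp0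
  have hσS : σ (∑ j ∈ Finset.range (p ^ s), zetaEl (p ^ (r + s)) ^
        (b * (1 + (p : ℤ) ^ r) ^ j - (a : ℤ) * (p : ℤ) ^ r * (j : ℤ))) =
      ∑ j ∈ Finset.range (p ^ s), (zetaEl (p ^ (r + s)))⁻¹ ^
        (b * (1 + (p : ℤ) ^ r) ^ j - (a : ℤ) * (p : ℤ) ^ r * (j : ℤ)) := by
    rw [map_sum]
    exact Finset.sum_congr rfl fun j _ => by rw [map_zpow₀, hσ]
  refine ⟨fun hsr hd => ?_, fun hrs hd => ?_, fun hn => ?_⟩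
  · rw [aux_small p r s hp hζ h0 hsr, if_pos hd, map_mul, abs_mul, hnorm]
    have h1 : |Algebra.norm ℚ (zetaEl (p ^ (r + s)) ^ b)| = 1 := by
      have : Algebra.norm ℚ (zetaEl (p ^ (r + s)) ^ b) ^ (p ^ (r + s)) = 1 := by
        rw [← map_pow, ← zpow_natCast, zpow_comm, zpow_natCast, hζ.pow_eq_one, one_zpow, map_one]
      have h2 : |Algebra.norm ℚ (zetaEl (p ^ (r + s)) ^ b)| ^ (p ^ (r + s)) = 1 := by
        rw [← abs_pow, this, abs_one]
      exact (pow_eq_one_iff_of_nonneg (abs_nonneg _) hp0).mp h2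
    rw [h1, one_mul, abs_of_nonneg (by positivity)]
    push_cast
    rw [← pow_mul, mul_assoc]
  · have hbig := aux_big p r s hp hodd hr hζ h0 hrs a b hb
    rw [if_pos hd, ← hσS] at hbig
    have hN := congrArg (Algebra.norm ℚ) hbig
    rw [map_mul, Algebra.norm_eq_of_algEquiv, hnorm] at hN
    have heven : 2 ∣ (s + r) * (p - 1) * p ^ (r + s - 1) := by
      obtain ⟨k, hk⟩ := hp.odd_of_ne_two hodd
      exact ((Dvd.intro k (by omega : 2 * k = p - 1)).mul_left _).mul_right _
    obtain ⟨e, he⟩ := heven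
    rw [he, Nat.mul_div_cancel_left _ (by norm_num)]
    rw [← sq_eq_sq₀ (abs_nonneg _) (by positivity), sq_abs, sq, hN, ← pow_mul]
    push_cast
    rw [← pow_mul, ← mul_assoc, he, mul_comm]
  · rcases le_or_gt s r with hsr | hrs
    · rw [aux_small p r s hp hζ h0 hsr, if_neg (fun h => hn (Or.inl ⟨hsr, h⟩)), mul_zero]
    · have hbig := aux_big p r s hp hodd hr hζ h0 hrs a b hb
      rw [if_neg (fun h => hn (Or.inr ⟨hrs, h⟩)), ← hσS] at hbig
      rcases mul_eq_zero.mp hbig with h | h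
      · exact h
      · exact (map_eq_zero_iff σ σ.injective).mp h

end
end
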